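/- Let S : (0,1] × (0,∞) → ℝ be a measurable scoring function that is balanced with lexicographic tie-breaking: for all n ∈ ℕ and all positive reals α_1, …, α_n, when X_1, …, X_n are i.i.d. uniform on [0,1], the probability that j is the lexicographically-first index minimizing S(X_i, α_i) equals α_j / (α_1 + ⋯ + α_n). Then for every α > 0, the distribution of S(X, α), where X is uniform on [0,1], has no point masses (i.e., the pushforward measure is atomless). -/

import Mathlib

open MeasureTheory ProbabilityTheory

/-- If a measurable scoring function `S` is balanced with lexicographic tie-breaking
(for all `n` and positive rates `α 1, …, α n`, under the product of uniform distributions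
on `[0,1]`, the probability that `j` is the lexicographically-first minimizer of
`S (x i) (α i)` equals `α j / ∑ i, α i`), then for every `α > 0` the distribution of
`S(X, α)` under `X` uniform on `[0,1]` has no point masses. -/
theorem balanced_scoring_no_atoms (S : ℝ → ℝ → ℝ) (hS : Measurable (Function.uncurry S))
    (hbal : ∀ (n : ℕ) (α : Fin n → ℝ), (∀ i, 0 < α i) → ∀ j : Fin n,
      (Measure.pi fun _ : Fin n => volume.restrict (Set.Icc (0 : ℝ) 1))
        {x | (∀ i, S (x j) (α j) ≤ S (x i) (α i)) ∧
             (∀ i, i < j → S (x j) (α j) < S (x i) (α i))}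
        = ENNReal.ofReal (α j / ∑ i, α i)) :
    ∀ α : ℝ, 0 < α → ∀ y : ℝ,
      ((volume.restrict (Set.Icc (0 : ℝ) 1)).map (fun x => S x α)) {y} = 0 := by
  intro α hα y
  set μ : Measure ℝ := volume.restrict (Set.Icc (0 : ℝ) 1)
  have hf : Measurable fun x => S x α := hS.comp (measurable_id.prodMk measurable_const)
  rw [Measure.map_apply hf (measurableSet_singleton y)]
  set E : Set ℝ := (fun x => S x α) ⁻¹' {y}
  have hEm : MeasurableSet E := hf (measurableSet_singleton y)
  set le01 : Set (Fin 2 → ℝ) := {x | S (x 0) α ≤ S (x 1) α} with hle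
  set lt10 : Set (Fin 2 → ℝ) := {x | S (x 1) α < S (x 0) α} with hlt
  have hle_meas : Measure.pi (fun _ : Fin 2 => μ) le01 = ENNReal.ofReal (1 / 2) := by
    convert hbal 2 (fun _ => α) (fun _ => hα) 0 using 2
    · ext x
      simp [hle, Fin.forall_fin_two]
    · simp
      field_simp
  have hlt_meas : Measure.pi (fun _ : Fin 2 => μ) lt10 = ENNReal.ofReal (1 / 2) := by
    convert hbal 2 (fun _ => α) (fun _ => hα) 1 using 2
    · ext x
      simpa [hlt, Fin.forall_fin_two] using le_of_lt
    · simp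
      field_simp
  have hlt_ms : MeasurableSet lt10 :=
    measurableSet_lt (hf.comp (measurable_pi_apply 1)) (hf.comp (measurable_pi_apply 0))
  set swapped : Set (Fin 2 → ℝ) := {x | S (x 0) α < S (x 1) α}
  have hsw_meas : Measure.pi (fun _ : Fin 2 => μ) swapped = ENNReal.ofReal (1 / 2) := by
    rw [← hlt_meas, ← (measurePreserving_piCongrLeft (fun _ : Fin 2 => μ)
      (Equiv.swap 0 1)).measure_preimage hlt_ms.nullMeasurableSet]
    congr 1
  have hbox : MeasurableSet (Set.univ.pi fun _ : Fin 2 => E) := MeasurableSet.univ_pi fun _ => hEm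
  have hdisj : Disjoint swapped (Set.univ.pi fun _ : Fin 2 => E) := by
    refine Set.disjoint_left.mpr fun x hx hx' => ?_
    have h0 : S (x 0) α = y := hx' 0 trivial
    have h1 : S (x 1) α = y := hx' 1 trivial
    exact hx.ne (h0.trans h1.symm)
  have hsub : swapped ∪ (Set.univ.pi fun _ : Fin 2 => E) ⊆ le01 := by
    rintro x (hx | hx)
    · exact (show S (x 0) α < S (x 1) α from hx).le
    · have h0 : S (x 0) α = y := hx 0 trivial
      have h1 : S (x 1) α = y := hx 1 trivial
      exact (h0.trans h1.symm).le
  have hbound := measure_mono (μ := Measure.pi fun _ : Fin 2 => μ) hsub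
  rw [measure_union hdisj hbox, hsw_meas, hle_meas, Measure.pi_pi] at hbound
  have hzero : ∏ _i : Fin 2, μ E = 0 := by
    have h := ENNReal.le_sub_of_add_le_left ENNReal.ofReal_ne_top hbound
    simpa using h
  simpa using hzero
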